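/- arXiv:2404.16324 — 2 statements merged into one kernel-verified Lean document; each statement's English description precedes it below -/
import Mathlib

section
/- Let K : (P → ℝ) → (Fin M → ℝ) be a linear map, u : P → ℝ, and y ∈ (Fin M → ℝ). Suppose the set S = { x : P → ℝ : Kx = y } is nonempty and ker K ∩ ker Δ_u = {0}. Then there exists x̄ ∈ S with ‖Δ_u x̄‖₁ = min{ ‖Δ_u x‖₁ : x ∈ S }; that is, a graph-minimizing solution with respect to u exists. -/
open Finset Filter Topology

/-- ℓ¹ distance between two pixels on the grid `Fin n × Fin m`. -/
def dist1 {n m : ℕ} (p q : Fin n × Fin m) : ℕ :=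
  ((p.1 : ℤ) - (q.1 : ℤ)).natAbs + ((p.2 : ℤ) - (q.2 : ℤ)).natAbs

/-- Edge-weight function `w_u` built from the image `u`, with parameters `σ` and `R`. -/
noncomputable def wgt {n m : ℕ} (σ R : ℝ) (u : Fin n × Fin m → ℝ)
    (p q : Fin n × Fin m) : ℝ :=
  if 0 < dist1 p q ∧ (dist1 p q : ℝ) ≤ R then Real.exp (-(u p - u q) ^ 2 / σ) else 0

/-- Graph Laplacian `Δ_u` applied to `z`. -/
noncomputable def lap {n m : ℕ} (σ R : ℝ) (u z : Fin n × Fin m → ℝ)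
    (p : Fin n × Fin m) : ℝ :=
  ∑ q, wgt σ R u p q * (z p - z q)

/-- ℓ¹ norm on the pixel grid. -/
noncomputable def norm1 {n m : ℕ} (z : Fin n × Fin m → ℝ) : ℝ := ∑ p, |z p|

/-- Euclidean norm on `Fin M → ℝ`. -/
noncomputable def norm2 {M : ℕ} (v : Fin M → ℝ) : ℝ := Real.sqrt (∑ i, (v i) ^ 2)

/-- Euclidean norm on the pixel grid. -/
noncomputable def norm2P {n m : ℕ} (z : Fin n × Fin m → ℝ) : ℝ :=
  Real.sqrt (∑ p, (z p) ^ 2)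

/-- The graph Laplacian `Δ_u` as a linear map. -/
noncomputable def lapLinearMap {n m : ℕ} (σ R : ℝ) (u : Fin n × Fin m → ℝ) :
    (Fin n × Fin m → ℝ) →ₗ[ℝ] (Fin n × Fin m → ℝ) where
  toFun := lap σ R u
  map_add' x z := by
    ext p
    simp only [lap, Pi.add_apply, ← Finset.sum_add_distrib]
    exact Finset.sum_congr rfl fun q _ => by ring
  map_smul' c x := by
    ext p
    simp only [lap, Pi.smul_apply, smul_eq_mul, RingHom.id_apply, Finset.mul_sum]
    exact Finset.sum_congr rfl fun q _ => by ring

theorem norm_le_norm1 {n m : ℕ} (z : Fin n × Fin m → ℝ) : ‖z‖ ≤ norm1 z := by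
  refine (pi_norm_le_iff_of_nonneg (Finset.sum_nonneg fun p _ => abs_nonneg (z p))).2 fun p => ?_
  exact Finset.single_le_sum (f := fun q => |z q|) (fun q _ => abs_nonneg (z q)) (Finset.mem_univ p)

theorem continuous_norm1 {n m : ℕ} : Continuous (norm1 : (Fin n × Fin m → ℝ) → ℝ) := by
  unfold norm1
  fun_prop

/-- Existence of a graph-minimizing solution with respect to `u`. -/
theorem graph_minimizing_solution_exists
    (n m M : ℕ) (hn : 1 ≤ n) (hm : 1 ≤ m)
    (σ R : ℝ) (hσ : 0 < σ) (hR : 0 < R)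
    (K : (Fin n × Fin m → ℝ) →ₗ[ℝ] (Fin M → ℝ))
    (u : Fin n × Fin m → ℝ) (y : Fin M → ℝ)
    (hS : ∃ x : Fin n × Fin m → ℝ, K x = y)
    (hker : ∀ x : Fin n × Fin m → ℝ, K x = 0 → lap σ R u x = 0 → x = 0) :
    ∃ xbar : Fin n × Fin m → ℝ, K xbar = y ∧
      ∀ x : Fin n × Fin m → ℝ, K x = y →
        norm1 (lap σ R u xbar) ≤ norm1 (lap σ R u x) := by
  obtain ⟨x₀, hx₀⟩ := hS
  let L := lapLinearMap σ R u
  have hinj : LinearMap.ker (K.prod L) = ⊥ := by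
    refine LinearMap.ker_eq_bot'.2 fun x hx => ?_
    exact hker x (congrArg Prod.fst hx) (congrArg Prod.snd hx)
  have hlim : Tendsto (fun x => ‖(K.prod L) x‖) (cocompact _) atTop :=
    tendsto_norm_cocompact_atTop.comp
      (LinearMap.isClosedEmbedding_of_injective hinj).tendsto_cocompact
  have hclosed : IsClosed {x | K x = y} :=
    isClosed_eq K.continuous_of_finiteDimensional continuous_const
  have hcont : Continuous fun x => norm1 (L x) :=
    continuous_norm1.comp L.continuous_of_finiteDimensional
  have hev : ∀ᶠ x in cocompact (Fin n × Fin m → ℝ) ⊓ 𝓟 {x | K x = y},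
      norm1 (L x₀) ≤ norm1 (L x) := by
    rw [eventually_inf_principal]
    filter_upwards [hlim.eventually_gt_atTop (‖y‖ + norm1 (L x₀))] with x hx hxy
    have hxy : K x = y := hxy
    have hle : ‖(K.prod L) x‖ ≤ ‖y‖ + norm1 (L x) := by
      change max ‖K x‖ ‖L x‖ ≤ _
      rw [hxy]
      have h := norm_le_norm1 (L x)
      exact max_le (by linarith [(norm_nonneg _).trans h]) (by linarith [norm_nonneg y])
    linarith
  obtain ⟨xbar, hxbar, hmin⟩ := hcont.continuousOn.exists_isMinOn' hclosed hx₀ hev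
  exact ⟨xbar, hxbar, fun x hx => hmin hx⟩
end

section
/- Let K : (P → ℝ) → (Fin M → ℝ) be a linear map and y = K x† for some x† : P → ℝ. Let δ_k → 0, let y^{δ_k} satisfy ‖y^{δ_k} − y‖₂ ≤ δ_k, let α : (0,∞) → (0,∞) satisfy α(δ_k) → 0, and let x₀^{(k)} : P → ℝ be any sequence of images. If for each k, x_k minimizes x ↦ (1/2)‖Kx − y^{δ_k}‖₂² + α(δ_k)‖Δ_{x₀^{(k)}} x‖₁, then ‖K x_k − y^{δ_k}‖₂² ≤ δ_k² + 2α(δ_k)‖Δ_{x₀^{(k)}} x†‖₁ for all k, and K x_k → y as k → ∞. -/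
open Finset Filter Topology

lemma wgt_nonneg {n m : ℕ} (σ R : ℝ) (u : Fin n × Fin m → ℝ) (p q : Fin n × Fin m) :
    0 ≤ wgt σ R u p q := by
  unfold wgt
  split_ifs <;> positivity

lemma wgt_le_one {n m : ℕ} {σ : ℝ} (hσ : 0 < σ) (R : ℝ) (u : Fin n × Fin m → ℝ)
    (p q : Fin n × Fin m) : wgt σ R u p q ≤ 1 := by
  unfold wgt
  split_ifs
  · exact Real.exp_le_one_iff.2 <|
      div_nonpos_of_nonpos_of_nonneg (neg_nonpos.2 (sq_nonneg _)) hσ.le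
  · exact zero_le_one

/-- The ℓ¹ norm of `Δ_u z` is bounded independently of the image `u` that builds the graph. -/
lemma norm1_lap_le {n m : ℕ} {σ : ℝ} (hσ : 0 < σ) (R : ℝ) (u z : Fin n × Fin m → ℝ) :
    norm1 (lap σ R u z) ≤ ∑ p, ∑ q, |z p - z q| := by
  refine Finset.sum_le_sum fun p _ => (Finset.abs_sum_le_sum_abs _ _).trans ?_
  refine Finset.sum_le_sum fun q _ => ?_
  rw [abs_mul, abs_of_nonneg (wgt_nonneg σ R u p q)]
  exact mul_le_of_le_one_left (abs_nonneg _) (wgt_le_one hσ R u p q)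

lemma norm1_nonneg {n m : ℕ} (z : Fin n × Fin m → ℝ) : 0 ≤ norm1 z :=
  Finset.sum_nonneg fun _ _ => abs_nonneg _

lemma abs_le_norm2 {M : ℕ} (v : Fin M → ℝ) (i : Fin M) : |v i| ≤ norm2 v :=
  Real.abs_le_sqrt <|
    Finset.single_le_sum (f := fun j => v j ^ 2) (fun _ _ => sq_nonneg _) (Finset.mem_univ i)

lemma norm2_nonneg {M : ℕ} (v : Fin M → ℝ) : 0 ≤ norm2 v := Real.sqrt_nonneg _

lemma norm2_sub_comm {M : ℕ} (v w : Fin M → ℝ) :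
    norm2 (fun i => v i - w i) = norm2 (fun i => w i - v i) := by
  simp only [norm2, sub_sq_comm]

/-- Residual bound for minimizers of the graph-Tikhonov functionals and
convergence of the residuals `K x_k → y`. -/
theorem graphLa_residual_convergence
    (n m M : ℕ) (hn : 1 ≤ n) (hm : 1 ≤ m)
    (σ R : ℝ) (hσ : 0 < σ) (hR : 0 < R)
    (K : (Fin n × Fin m → ℝ) →ₗ[ℝ] (Fin M → ℝ))
    (xdag : Fin n × Fin m → ℝ) (y : Fin M → ℝ) (hy : y = K xdag)
    (δ : ℕ → ℝ) (hδpos : ∀ k, 0 < δ k)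
    (hδ0 : Tendsto δ atTop (𝓝 0))
    (yδ : ℕ → Fin M → ℝ) (hyδ : ∀ k, norm2 (fun i => yδ k i - y i) ≤ δ k)
    (α : ℝ → ℝ) (hαpos : ∀ t, 0 < t → 0 < α t)
    (hα0 : Tendsto (fun k => α (δ k)) atTop (𝓝 0))
    (x0seq : ℕ → Fin n × Fin m → ℝ)
    (xk : ℕ → Fin n × Fin m → ℝ)
    (hmin : ∀ k, ∀ x : Fin n × Fin m → ℝ,
      (1 / 2) * (norm2 (fun i => K (xk k) i - yδ k i)) ^ 2
          + α (δ k) * norm1 (lap σ R (x0seq k) (xk k))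
        ≤ (1 / 2) * (norm2 (fun i => K x i - yδ k i)) ^ 2
          + α (δ k) * norm1 (lap σ R (x0seq k) x)) :
    (∀ k, (norm2 (fun i => K (xk k) i - yδ k i)) ^ 2
        ≤ (δ k) ^ 2 + 2 * α (δ k) * norm1 (lap σ R (x0seq k) xdag)) ∧
    Tendsto (fun k => K (xk k)) atTop (𝓝 y) := by
  have hres : ∀ k, (norm2 (fun i => K (xk k) i - yδ k i)) ^ 2
      ≤ (δ k) ^ 2 + 2 * α (δ k) * norm1 (lap σ R (x0seq k) xdag) := by
    intro k
    have hk := hmin k xdag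
    rw [← hy, norm2_sub_comm y] at hk
    have hnoise := pow_le_pow_left₀ (norm2_nonneg _) (hyδ k) 2
    have hreg := mul_nonneg (hαpos _ (hδpos k)).le (norm1_nonneg (lap σ R (x0seq k) (xk k)))
    linarith
  refine ⟨hres, tendsto_pi_nhds.2 fun i => tendsto_iff_dist_tendsto_zero.2 ?_⟩
  set C := ∑ p, ∑ q, |xdag p - xdag q|
  have hbound : Tendsto (fun k => Real.sqrt ((δ k) ^ 2 + 2 * α (δ k) * C) + δ k)
      atTop (𝓝 0) := by
    simpa using (((hδ0.pow 2).add ((hα0.const_mul 2).mul_const C)).sqrt).add hδ0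
  refine squeeze_zero (fun _ => dist_nonneg) (fun k => ?_) hbound
  have hα := hαpos _ (hδpos k)
  have hfit : norm2 (fun i => K (xk k) i - yδ k i)
      ≤ Real.sqrt ((δ k) ^ 2 + 2 * α (δ k) * C) := by
    refine Real.le_sqrt_of_sq_le ((hres k).trans ?_)
    gcongr
    exact norm1_lap_le hσ R (x0seq k) xdag
  rw [Real.dist_eq]
  exact (abs_sub_le _ (yδ k i) _).trans <| add_le_add
    ((abs_le_norm2 (fun i => K (xk k) i - yδ k i) i).trans hfit)
    ((abs_le_norm2 (fun i => yδ k i - y i) i).trans (hyδ k))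
end
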